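/- arXiv:1609.06180 — 2 statements merged into one kernel-verified Lean document; each statement's English description precedes it below -/
import Mathlib

section
/- Let E be a homogeneous effect algebra and let a ∈ E be an atom such that a ≤ a'. If v₁, v₂ ∈ E with v₁ ⊥ v₂ and v₁ ⊕ v₂ ∈ [a, a'], then a ≤ v₁ or a ≤ v₂. -/
namespace EffectAlgebraPaper

/-- An effect algebra: a set with 0, 1 and a partially defined sum `add`,
whose domain is the relation `Orth` (written `a ⊥ b` in the paper). -/
class EffectAlgebra (E : Type*) where
  zero : E
  one : E
  /-- `Orth a b` means `a ⊕ b` is defined. -/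
  Orth : E → E → Prop
  /-- The sum `a ⊕ b`, meaningful only when `Orth a b`. -/
  add : E → E → E
  orth_comm : ∀ a b : E, Orth a b → Orth b a
  add_comm : ∀ a b : E, Orth a b → add a b = add b a
  assoc : ∀ a b c : E, Orth b c → Orth a (add b c) →
    Orth a b ∧ Orth (add a b) c ∧ add a (add b c) = add (add a b) c
  compl_exists : ∀ a : E, ∃! b : E, Orth a b ∧ add a b = one
  orth_one : ∀ a : E, Orth a one → a = zero

namespace EffectAlgebra

variable {E : Type*} [EffectAlgebra E]

/-- The orthosupplement `a'`. -/
noncomputable def compl (a : E) : E := (compl_exists a).exists.choose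

/-- The effect-algebra partial order: `a ≤ b` iff `a ⊕ c = b` for some `c`. -/
def le (a b : E) : Prop := ∃ c : E, Orth a c ∧ add a c = b

/-- The interval `[x, y] = {z : x ≤ z ≤ y}`. -/
def Interval (x y : E) : Set E := { z : E | le x z ∧ le z y }

/-- An atom: a minimal nonzero element. -/
def Atom (a : E) : Prop := a ≠ zero ∧ ∀ b : E, b ≠ zero → le b a → b = a

/-- A sharp element: the only common lower bound of `x` and `x'` is `0`. -/
def Sharp (x : E) : Prop := ∀ b : E, le b x → le b (compl x) → b = zero

/-- `S(E)`, the set of sharp elements. -/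
def sharpSet (E : Type*) [EffectAlgebra E] : Set E := { x : E | Sharp x }

/-- Homogeneity: `u ≤ v₁ ⊕ v₂ ≤ u'` implies `u = u₁ ⊕ u₂` with `u₁ ≤ v₁`, `u₂ ≤ v₂`. -/
def Homogeneous (E : Type*) [EffectAlgebra E] : Prop :=
  ∀ u v₁ v₂ : E, Orth v₁ v₂ → le u (add v₁ v₂) → le (add v₁ v₂) (compl u) →
    ∃ u₁ u₂ : E, le u₁ v₁ ∧ le u₂ v₂ ∧ Orth u₁ u₂ ∧ add u₁ u₂ = u

/-- `nmul n a` is the iterated sum `n·a = a ⊕ ⋯ ⊕ a` (`n` times), with `0·a = 0`;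
it is meaningful only when `nmulDef n a` holds. -/
def nmul : ℕ → E → E
  | 0, _ => zero
  | n + 1, a => add (nmul n a) a

/-- `nmulDef n a` says the iterated sum `n·a` is well defined. -/
def nmulDef : ℕ → E → Prop
  | 0, _ => True
  | n + 1, a => nmulDef n a ∧ Orth (nmul n a) a

end EffectAlgebra

open EffectAlgebra

namespace EffectAlgebra

theorem orth_zero_one {E : Type*} [EffectAlgebra E] :
    Orth (zero : E) one ∧ add (zero : E) one = one := by
  obtain ⟨b, ⟨hb, hb1⟩, -⟩ := compl_exists (one : E)
  obtain rfl := orth_one b (orth_comm _ _ hb)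
  exact ⟨orth_comm _ _ hb, (add_comm _ _ hb).symm.trans hb1⟩

protected theorem zero_add {E : Type*} [EffectAlgebra E] (a : E) : add zero a = a := by
  obtain ⟨b, ⟨hb, hb1⟩, -⟩ := compl_exists a
  obtain ⟨h01, hs⟩ := orth_zero_one (E := E)
  obtain ⟨-, ho, he⟩ := assoc zero a b hb (hb1.symm ▸ h01)
  rw [hb1, hs] at he
  exact (compl_exists b).unique ⟨orth_comm _ _ ho, (add_comm _ _ ho).symm.trans he.symm⟩
    ⟨orth_comm _ _ hb, (add_comm _ _ hb).symm.trans hb1⟩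

end EffectAlgebra

/-- Lemma 1 (lem22): In a homogeneous effect algebra, if `a` is an atom with `a ≤ a'`,
`v₁ ⊥ v₂` and `v₁ ⊕ v₂ ∈ [a, a']`, then `a ≤ v₁` or `a ≤ v₂`. -/
theorem stmt0 {E : Type*} [EffectAlgebra E] (hhom : Homogeneous E)
    (a : E) (ha : Atom a) (haa : le a (compl a))
    (v₁ v₂ : E) (hv : Orth v₁ v₂) (hmem : add v₁ v₂ ∈ Interval a (compl a)) :
    le a v₁ ∨ le a v₂ := by
  obtain ⟨u₁, u₂, h₁, h₂, ho, hs⟩ := hhom a v₁ v₂ hv hmem.1 hmem.2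
  by_cases hz₁ : u₁ = zero
  · by_cases hz₂ : u₂ = zero
    · subst hz₁ hz₂
      exact absurd (hs.symm.trans (EffectAlgebra.zero_add zero)) ha.1
    · right
      rwa [← ha.2 u₂ hz₂ ⟨u₁, orth_comm _ _ ho, (EffectAlgebra.add_comm _ _ ho).symm.trans hs⟩]
  · left
    rwa [← ha.2 u₁ hz₁ ⟨u₂, ho, hs⟩]

end EffectAlgebraPaper
end

section
/- Let E be a finite effect algebra such that S(E) = {0, 1}, and let {a₁, …, a_k} be the set of all atoms of E. Then E = {0, 1} ∪ ⋃_{n=1}^{k} [a_n, a_n']. -/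
namespace EffectAlgebraPaper

namespace EffectAlgebra

variable {E : Type*} [EffectAlgebra E]

theorem orth_compl (a : E) : Orth a (compl a) := (compl_exists a).exists.choose_spec.1

theorem add_compl (a : E) : add a (compl a) = one := (compl_exists a).exists.choose_spec.2

theorem eq_compl {a b : E} (h : Orth a b) (hab : add a b = one) : b = compl a :=
  (compl_exists a).unique ⟨h, hab⟩ ⟨orth_compl a, add_compl a⟩

theorem compl_compl (a : E) : compl (compl a) = a :=
  (eq_compl (orth_comm _ _ (orth_compl a))
    ((add_comm _ _ (orth_comm _ _ (orth_compl a))).trans (add_compl a))).symm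

theorem assoc_right {a b c : E} (h : Orth a b) (h' : Orth (add a b) c) :
    Orth b c ∧ Orth a (add b c) ∧ add (add a b) c = add a (add b c) := by
  obtain ⟨hcb, hcba, heq⟩ := assoc c b a (orth_comm _ _ h)
    (add_comm _ _ h ▸ orth_comm _ _ h')
  have hbc := orth_comm _ _ hcb
  rw [add_comm _ _ hcb] at hcba heq
  refine ⟨hbc, orth_comm _ _ hcba, ?_⟩
  rw [add_comm _ _ h', add_comm _ _ h, heq, add_comm _ _ hcba]

theorem compl_one : compl (one : E) = zero := orth_one _ (orth_comm _ _ (orth_compl one))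

theorem orth_zero_left_and_zero_add (a : E) : Orth zero a ∧ add zero a = a := by
  have h10 : Orth (one : E) zero := compl_one (E := E) ▸ orth_compl one
  have h : add (one : E) zero = one := by simpa only [compl_one] using add_compl (one : E)
  obtain ⟨h0a, h', heq⟩ := assoc zero a (compl a) (orth_compl a)
    ((add_compl a).symm ▸ orth_comm _ _ h10)
  rw [add_compl, ← add_comm _ _ h10, h] at heq
  refine ⟨h0a, ?_⟩
  rw [eq_compl (orth_comm _ _ h') ((add_comm _ _ (orth_comm _ _ h')).trans heq.symm),
    compl_compl]

theorem add_zero (a : E) : add a zero = a := by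
  obtain ⟨h, h'⟩ := orth_zero_left_and_zero_add a
  rw [← add_comm _ _ h, h']

theorem le_refl (a : E) : le a a :=
  ⟨zero, orth_comm _ _ (orth_zero_left_and_zero_add a).1, add_zero a⟩

theorem le_trans {a b c : E} (hab : le a b) (hbc : le b c) : le a c := by
  obtain ⟨d, hd, rfl⟩ := hab
  obtain ⟨e, he, rfl⟩ := hbc
  obtain ⟨-, h, heq⟩ := assoc_right hd he
  exact ⟨_, h, heq.symm⟩

theorem eq_zero_of_add_eq_self {a u : E} (h : Orth a u) (hau : add a u = a) : u = zero := by
  have hc := orth_comm _ _ (orth_compl a)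
  obtain ⟨-, h', -⟩ := assoc (compl a) a u h (hau.symm ▸ hc)
  rw [add_comm _ _ hc, add_compl] at h'
  exact orth_one _ (orth_comm _ _ h')

theorem eq_zero_of_add_eq_zero {a b : E} (h : Orth a b) (hab : add a b = zero) : a = zero := by
  have h1 : Orth (one : E) (add a b) :=
    hab.symm ▸ orth_comm _ _ (orth_zero_left_and_zero_add one).1
  exact orth_one _ (orth_comm _ _ (assoc one a b h h1).1)

theorem le_antisymm {a b : E} (hab : le a b) (hba : le b a) : a = b := by
  obtain ⟨d, hd, rfl⟩ := hab
  obtain ⟨e, he, heq⟩ := hba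
  obtain ⟨hde, h, h'⟩ := assoc_right hd he
  rw [eq_zero_of_add_eq_zero hde (eq_zero_of_add_eq_self h (h'.symm.trans heq)), add_zero]

theorem exists_atom_le [Finite E] {b : E} (hb : b ≠ zero) : ∃ a : E, Atom a ∧ le a b := by
  let _ : PartialOrder E :=
    { le := le
      le_refl := le_refl
      le_trans := fun _ _ _ => le_trans
      le_antisymm := fun _ _ => le_antisymm }
  obtain ⟨a, hab, ha⟩ := (Set.toFinite {c : E | c ≠ zero}).exists_le_minimal hb
  exact ⟨a, ⟨ha.prop, fun c hc hca => ha.eq_of_le hc hca⟩, hab⟩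

theorem le_compl_comm {a x : E} (h : le a (compl x)) : le x (compl a) := by
  obtain ⟨c, hac, hc⟩ := h
  have hca := add_comm _ _ hac ▸ hc
  obtain ⟨hxc, h', heq⟩ := assoc x c a (orth_comm _ _ hac) (hca.symm ▸ orth_compl x)
  rw [hca, add_compl, add_comm _ _ h'] at heq
  exact ⟨c, hxc, eq_compl (orth_comm _ _ h') heq.symm⟩

end EffectAlgebra

open EffectAlgebra

/-- Lemma 4 (lem20): if `E` is a finite effect algebra with `S(E) = {0, 1}`, then
`E = {0, 1} ∪ ⋃_{a atom} [a, a']`. -/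
theorem stmt3 {E : Type*} [EffectAlgebra E] [Finite E]
    (hS : sharpSet E = {zero, one}) :
    (Set.univ : Set E) =
      {zero, one} ∪ ⋃ a ∈ { a : E | Atom a }, Interval a (compl a) := by
  refine (Set.eq_univ_of_forall fun x => ?_).symm
  by_cases hx : x ∈ sharpSet E
  · exact Or.inl (hS ▸ hx)
  · simp only [sharpSet, Set.mem_ofPred_eq, Sharp, not_forall] at hx
    obtain ⟨b, hbx, hbx', hb⟩ := hx
    obtain ⟨a, ha, hab⟩ := exists_atom_le hb
    exact Or.inr (Set.mem_biUnion (x := a) ha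
      ⟨le_trans hab hbx, le_compl_comm (le_trans hab hbx')⟩)

end EffectAlgebraPaper
end
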